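/- arXiv:1108.0908 — 2 statements merged into one kernel-verified Lean document; each statement's English description precedes it below -/
import Mathlib

section
/- Let n ≥ 2. Every rank-2 element of F^{2,n}, i.e. every x with T(x) = 0 for which there exists y with Υ(x, y) ≠ 0, is Aut-related to one of the canonical forms x_{2a} = (1, 0, (1; 0, …, 0), 0), x_{2b} = (1, 0, (−1; 0, …, 0), 0), or x_{2c} = (1, 0, (0; ½, ½, 0, …, 0), 0). -/
open Real Matrix

/-- The underlying vector space of the spin factor `J_{1,n-1} = ℝ ⊕ Γ_{1,n-1}`. -/
abbrev J (n : ℕ) : Type := ℝ × (Fin n → ℝ)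

/-- The Lorentzian quadratic form `Q(v) = v₀² - v₁² - ⋯ - v_{n-1}²`. -/
noncomputable def Qf {n : ℕ} (v : Fin n → ℝ) : ℝ :=
  ∑ i : Fin n, (if (i : ℕ) = 0 then (1 : ℝ) else -1) * v i ^ 2

/-- The cubic norm `N(a; v) = a Q(v)`. -/
noncomputable def Nrm {n : ℕ} (A : J n) : ℝ := A.1 * Qf A.2

/-- The quadratic adjoint `A♯ = (Q(v); a v₀, -a v₁, …, -a v_{n-1})`. -/
noncomputable def sharp {n : ℕ} (A : J n) : J n :=
  (Qf A.2, fun i => if (i : ℕ) = 0 then A.1 * A.2 i else -(A.1 * A.2 i))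

/-- The vector with first two coordinates `x, y` and all other coordinates zero. -/
def vec2 {n : ℕ} (x y : ℝ) : Fin n → ℝ :=
  fun i => if (i : ℕ) = 0 then x else if (i : ℕ) = 1 then y else 0

/-- The Lorentzian metric `η = diag(1, -1, …, -1)`. -/
noncomputable def eta (n : ℕ) : Matrix (Fin n) (Fin n) ℝ :=
  Matrix.diagonal fun i => if (i : ℕ) = 0 then 1 else -1

/-- `Str₀`-relatedness: `B = (e^{2λ} a; e^{-λ} Λ v)` for some `λ ∈ ℝ` and
`Λ ∈ SO(1, n-1)`, i.e. `Λᵀ η Λ = η` and `det Λ = 1`. -/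
def StrRel {n : ℕ} (A B : J n) : Prop :=
  ∃ (l : ℝ) (Λ : Matrix (Fin n) (Fin n) ℝ),
    Λᵀ * eta n * Λ = eta n ∧ Λ.det = 1 ∧
      B = (Real.exp (2 * l) * A.1, fun i => Real.exp (-l) * Λ.mulVec A.2 i)

/-- The trace bilinear form `Tr(A,B) = ab + 2(a₀b₀ + ⋯ + a_{n-1}b_{n-1})`. -/
noncomputable def TrF {n : ℕ} (A B : J n) : ℝ :=
  A.1 * B.1 + 2 * ∑ i : Fin n, A.2 i * B.2 i

/-- The Freudenthal triple system `F^{2,n} = ℝ ⊕ ℝ ⊕ J ⊕ J`, with elements `(α, β, A, B)`. -/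
abbrev F (n : ℕ) : Type := ℝ × ℝ × J n × J n

/-- The antisymmetric bilinear form `{x, y} = αδ - βγ + Tr(A,D) - Tr(B,C)`. -/
noncomputable def symp {n : ℕ} (x y : F n) : ℝ :=
  x.1 * y.2.1 - x.2.1 * y.1 + TrF x.2.2.1 y.2.2.2 - TrF x.2.2.2 y.2.2.1

/-- The quartic form
`Δ(x) = -(αβ - Tr(A,B))² - 4(α N(A) + β N(B) - Tr(A♯, B♯))`. -/
noncomputable def Dlt {n : ℕ} (x : F n) : ℝ :=
  -(x.1 * x.2.1 - TrF x.2.2.1 x.2.2.2) ^ 2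
    - 4 * (x.1 * Nrm x.2.2.1 + x.2.1 * Nrm x.2.2.2 - TrF (sharp x.2.2.1) (sharp x.2.2.2))

/-- Membership in `Aut(F^{2,n})`: an invertible `ℝ`-linear map preserving `{,}` and `Δ`. -/
def IsAut {n : ℕ} (σ : F n → F n) : Prop :=
  Function.Bijective σ ∧ IsLinearMap ℝ σ ∧
    (∀ x y, symp (σ x) (σ y) = symp x y) ∧ ∀ x, Dlt (σ x) = Dlt x

/-- `Aut`-relatedness of two elements of `F^{2,n}`. -/
def AutRel {n : ℕ} (x y : F n) : Prop := ∃ σ, IsAut σ ∧ σ x = y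

/-- `T` is the triple-product map: `{T(x), z} = ½ (d/ds)|₀ Δ(x + s z)` for all `x, z`. -/
def IsTripleMap {n : ℕ} (T : F n → F n) : Prop :=
  ∀ x z, symp (T x) z = (1 / 2) * deriv (fun s : ℝ => Dlt (x + s • z)) 0

/-- `Υ(x, y) = (d/ds)|₀ T(x + s y) + {x, y} x`. -/
noncomputable def Ups {n : ℕ} (T : F n → F n) (x y : F n) : F n :=
  deriv (fun s : ℝ => T (x + s • y)) 0 + symp x y • x

namespace FTS

section Isometries

variable {V : Type*} [AddCommGroup V] [Module ℝ V] {B : LinearMap.BilinForm ℝ V}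

/-- `g` preserves the bilinear form `B`. -/
def Isometry (B : LinearMap.BilinForm ℝ V) (g : V →ₗ[ℝ] V) : Prop :=
  ∀ u v, B (g u) (g v) = B u v

lemma Isometry.comp {g h : V →ₗ[ℝ] V} (hg : Isometry B g) (hh : Isometry B h) :
    Isometry B (g ∘ₗ h) := fun u v => by simp [hg (h u) (h v), hh u v]

lemma isometry_neg : Isometry B (-LinearMap.id) := fun u v => by simp

/-- The reflection along `e`. -/
noncomputable def refl (B : LinearMap.BilinForm ℝ V) (e : V) : V →ₗ[ℝ] V :=
  LinearMap.id - (2 / B e e) • (B e).smulRight e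

lemma refl_apply (e v : V) : refl B e v = v - (2 / B e e * B e v) • e := by
  simp [refl, mul_smul]

lemma isometry_refl (hB : ∀ u v, B u v = B v u) {e : V} (he : B e e ≠ 0) :
    Isometry B (refl B e) := fun u v => by
  simp only [refl_apply, map_sub, map_smul, LinearMap.sub_apply, LinearMap.smul_apply, smul_eq_mul]
  rw [hB u e]
  field_simp
  ring

/-- A reflection exchanges two vectors of equal length whose difference is anisotropic. -/
lemma refl_sub (hB : ∀ u v, B u v = B v u) {u w : V} (h : B u u = B w w)
    (he : B (u - w) (u - w) ≠ 0) : refl B (u - w) u = w := by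
  have h2 : B (u - w) (u - w) = 2 * B (u - w) u := by
    simp only [map_sub, LinearMap.sub_apply]
    rw [hB w u, h]; ring
  rw [refl_apply]
  have h3 : 2 / B (u - w) (u - w) * B (u - w) u = 1 := by
    rw [h2] at he ⊢
    rw [div_mul_eq_mul_div, div_self he]
  rw [h3]; simp

lemma exists_isometry_of_anisotropic (hB : ∀ u v, B u v = B v u) {u w : V}
    (h : B u u = B w w) (hu : B u u ≠ 0) : ∃ g, Isometry B g ∧ g u = w := by
  by_cases he : B (u - w) (u - w) = 0
  · have he' : B (u - -w) (u - -w) ≠ 0 := fun h0 => hu (by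
      simp only [map_sub, LinearMap.sub_apply, map_neg, LinearMap.neg_apply] at he h0
      linarith)
    refine ⟨(-LinearMap.id) ∘ₗ refl B (u - -w), isometry_neg.comp (isometry_refl hB he'), ?_⟩
    rw [LinearMap.comp_apply, refl_sub hB (by simpa using h) he']
    simp
  · exact ⟨_, isometry_refl hB he, refl_sub hB h he⟩

/-- Two isotropic vectors that are not orthogonal are related by a reflection fixing every
vector orthogonal to both. -/
lemma exists_isometry_of_not_orthogonal (hB : ∀ u v, B u v = B v u) {p u w : V}
    (hu : B u u = 0) (hw : B w w = 0) (hpu : B p u = 0) (hpw : B p w = 0) (huw : B u w ≠ 0) :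
    ∃ g, Isometry B g ∧ g p = p ∧ g u = w := by
  have he : B (u - w) (u - w) ≠ 0 := fun h0 => huw (by
    simp only [map_sub, LinearMap.sub_apply] at h0
    rw [hB w u] at h0
    linarith)
  refine ⟨_, isometry_refl hB he, ?_, refl_sub hB (hu.trans hw.symm) he⟩
  rw [refl_apply, hB _ p]
  simp [hpu, hpw]

lemma exists_isometry_of_isotropic (hB : ∀ u v, B u v = B v u) {p u w : V}
    (hu : B u u = 0) (hw : B w w = 0) (hpu : B p u = 0) (hpw : B p w = 0)
    (hzu : ∃ z, B p z = 0 ∧ B u z ≠ 0) (hzw : ∃ z, B p z = 0 ∧ B w z ≠ 0) :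
    ∃ g, Isometry B g ∧ g p = p ∧ g u = w := by
  by_cases huw : B u w = 0
  · obtain ⟨z, hpz, huz, hwz⟩ : ∃ z, B p z = 0 ∧ B u z ≠ 0 ∧ B w z ≠ 0 := by
      obtain ⟨y, hpy, huy⟩ := hzu
      obtain ⟨z, hpz, hwz⟩ := hzw
      by_cases hwy : B w y = 0
      · by_cases huz : B u z = 0
        · exact ⟨y + z, by simp [hpy, hpz], by simpa [huz] using huy, by simpa [hwy] using hwz⟩
        · exact ⟨z, hpz, huz, hwz⟩
      · exact ⟨y, hpy, huy, hwy⟩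
    obtain ⟨m, hpm, hum, hwm, hm⟩ :
        ∃ m, B p m = 0 ∧ B u m ≠ 0 ∧ B w m ≠ 0 ∧ B m m = 0 := by
      refine ⟨z - (B z z / (2 * B u z)) • u, ?_, ?_, ?_, ?_⟩
      · simp [hpz, hpu]
      · simpa [hu] using huz
      · simpa [hB w u, huw] using hwz
      · simp only [map_sub, map_smul, LinearMap.sub_apply, LinearMap.smul_apply, smul_eq_mul, hu,
          hB z u]
        field_simp
        ring
    obtain ⟨g, hg, hgp, hgu⟩ := exists_isometry_of_not_orthogonal hB hu hm hpu hpm hum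
    obtain ⟨h, hh, hhp, hhm⟩ :=
      exists_isometry_of_not_orthogonal hB hm hw hpm hpw (by rwa [hB])
    exact ⟨h ∘ₗ g, hh.comp hg, by simp [hgp, hhp], by simp [hgu, hhm]⟩
  · exact exists_isometry_of_not_orthogonal hB hu hw hpu hpw huw

/-- In a nondegenerate space, a vector orthogonal to the orthogonal complement of `p` is a
multiple of `p`. -/
lemma exists_orthogonal_of_notMem_span (hnd : ∀ u, (∀ z, B u z = 0) → u = 0) {p u : V}
    (hp : p ≠ 0) (hu : ∀ c : ℝ, u ≠ c • p) : ∃ z, B p z = 0 ∧ B u z ≠ 0 := by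
  by_contra! hcon
  obtain ⟨y, hy⟩ : ∃ y, B p y ≠ 0 := by
    by_contra! h0
    exact hp (hnd p h0)
  refine hu (B u y / B p y) (sub_eq_zero.mp (hnd _ fun z => ?_))
  have h := hcon (z - (B p z / B p y) • y) (by simp [hy])
  simp only [map_sub, map_smul, smul_eq_mul, LinearMap.sub_apply, LinearMap.smul_apply] at h ⊢
  rw [← h]
  ring

/-- Witt's theorem for bases of totally isotropic planes. -/
lemma exists_isometry_of_isotropic_plane (hB : ∀ u v, B u v = B v u)
    (hnd : ∀ u, (∀ z, B u z = 0) → u = 0) {p q p' q' : V}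
    (hp : p ≠ 0) (hq : ∀ c : ℝ, q ≠ c • p) (hp' : p' ≠ 0) (hq' : ∀ c : ℝ, q' ≠ c • p')
    (hpp : B p p = 0) (hqq : B q q = 0) (hpq : B p q = 0)
    (hpp' : B p' p' = 0) (hqq' : B q' q' = 0) (hpq' : B p' q' = 0) :
    ∃ g, Isometry B g ∧ g p = p' ∧ g q = q' := by
  have hex : ∀ {u : V}, u ≠ 0 → ∃ z, B 0 z = 0 ∧ B u z ≠ 0 := fun {u} h => by
    by_contra! h0
    exact h (hnd u fun z => h0 z (by simp))
  obtain ⟨g, hg, -, hgp⟩ := exists_isometry_of_isotropic hB (p := 0) hpp hpp' (by simp) (by simp)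
    (hex hp) (hex hp')
  have hpgq : B p' (g q) = 0 := by rw [← hgp, hg, hpq]
  have hgq : ∀ c : ℝ, g q ≠ c • p' := fun c hc => hq c (sub_eq_zero.mp (hnd _ fun z => by
    rw [← hg, map_sub, map_smul, hc, hgp, sub_self, map_zero, LinearMap.zero_apply]))
  obtain ⟨h, hh, hhp, hhq⟩ := exists_isometry_of_isotropic hB ((hg q q).trans hqq) hqq' hpgq hpq'
    (exists_orthogonal_of_notMem_span hnd hp' hgq) (exists_orthogonal_of_notMem_span hnd hp' hq')
  exact ⟨h ∘ₗ g, hh.comp hg, by simp [hgp, hhp], by simp [hhq]⟩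

end Isometries

section Coordinates

variable {n : ℕ}

/-- The diagonal entries of the Lorentzian metric. -/
noncomputable def sgn (i : Fin n) : ℝ := if (i : ℕ) = 0 then 1 else -1

lemma sgn_mul_self (i : Fin n) : sgn i * sgn i = 1 := by
  unfold sgn; split_ifs <;> norm_num

/-- The quadratic space `ℝ^{2,n}`. -/
abbrev V (n : ℕ) : Type := ℝ × ℝ × (Fin n → ℝ)

/-- The symmetric bilinear form of signature `(2, n)` on `V n`. -/
noncomputable def bil (n : ℕ) : LinearMap.BilinForm ℝ (V n) :=
  LinearMap.mk₂ ℝ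
    (fun u v => ∑ i, sgn i * u.2.2 i * v.2.2 i - (u.1 * v.2.1 + u.2.1 * v.1) / 2)
    (fun u u' v => by
      simp only [Prod.fst_add, Prod.snd_add, Pi.add_apply, mul_add, add_mul, Finset.sum_add_distrib]
      ring)
    (fun c u v => by
      simp only [Prod.smul_fst, Prod.smul_snd, Pi.smul_apply, smul_eq_mul, mul_sub, Finset.mul_sum]
      congr 1
      · exact Finset.sum_congr rfl fun i _ => by ring
      · ring)
    (fun u v v' => by
      simp only [Prod.fst_add, Prod.snd_add, Pi.add_apply, mul_add, Finset.sum_add_distrib]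
      ring)
    (fun c u v => by
      simp only [Prod.smul_fst, Prod.smul_snd, Pi.smul_apply, smul_eq_mul, mul_sub, Finset.mul_sum]
      congr 1
      · exact Finset.sum_congr rfl fun i _ => by ring
      · ring)

lemma bil_apply (u v : V n) :
    bil n u v = ∑ i, sgn i * u.2.2 i * v.2.2 i - (u.1 * v.2.1 + u.2.1 * v.1) / 2 := rfl

lemma bil_comm (u v : V n) : bil n u v = bil n v u := by
  simp only [bil_apply]
  congr 1
  · exact Finset.sum_congr rfl fun i _ => by ring
  · ring

lemma bil_nondegenerate (u : V n) (h : ∀ z, bil n u z = 0) : u = 0 := by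
  refine Prod.ext ?_ (Prod.ext ?_ (funext fun i => ?_))
  · simpa [bil_apply] using h (0, 1, 0)
  · simpa [bil_apply] using h (1, 0, 0)
  · have h1 : sgn i * u.2.2 i = 0 := by
      simpa [bil_apply, Pi.single_apply] using h (0, 0, Pi.single i 1)
    have h2 : u.2.2 i = sgn i * (sgn i * u.2.2 i) := by rw [← mul_assoc, sgn_mul_self, one_mul]
    rw [h2, h1, mul_zero]; rfl

/-- The identification `F^{2,n} ≅ ℝ^{2,n} ⊕ ℝ^{2,n}`. -/
noncomputable def coords (n : ℕ) : F n ≃ₗ[ℝ] V n × V n where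
  toFun x := ((x.2.1, x.2.2.2.1, x.2.2.1.2), (x.2.2.1.1, x.1, fun i => sgn i * x.2.2.2.2 i))
  invFun y := (y.2.2.1, y.1.1, (y.2.1, y.1.2.2), (y.1.2.1, fun i => sgn i * y.2.2.2 i))
  map_add' x y := by
    refine Prod.ext rfl (Prod.ext rfl (Prod.ext rfl (funext fun i => ?_)))
    simp [mul_add]
  map_smul' c x := by
    refine Prod.ext rfl (Prod.ext rfl (Prod.ext rfl (funext fun i => ?_)))
    simp [mul_left_comm]
  left_inv x := by
    simp only [← mul_assoc, sgn_mul_self, one_mul]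
  right_inv x := by
    simp only [← mul_assoc, sgn_mul_self, one_mul]

lemma coords_apply (x : F n) : coords n x =
    ((x.2.1, x.2.2.2.1, x.2.2.1.2), (x.2.2.1.1, x.1, fun i => sgn i * x.2.2.2.2 i)) := rfl

lemma symp_eq (x y : F n) : symp x y =
    2 * (bil n (coords n x).1 (coords n y).2 - bil n (coords n x).2 (coords n y).1) := by
  obtain ⟨α, β, ⟨a, v⟩, b, w⟩ := x
  obtain ⟨γ, δ, ⟨c, v'⟩, d, w'⟩ := y
  have h1 : ∑ i, sgn i * v i * (sgn i * w' i) = ∑ i, v i * w' i :=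
    Finset.sum_congr rfl fun i _ => by linear_combination v i * w' i * sgn_mul_self i
  have h2 : ∑ i, sgn i * (sgn i * w i) * v' i = ∑ i, w i * v' i :=
    Finset.sum_congr rfl fun i _ => by linear_combination v' i * w i * sgn_mul_self i
  simp only [symp, TrF, bil_apply, coords_apply, h1, h2]
  ring

lemma Dlt_eq (x : F n) : Dlt x =
    4 * (bil n (coords n x).1 (coords n x).1 * bil n (coords n x).2 (coords n x).2
      - bil n (coords n x).1 (coords n x).2 ^ 2) := by
  obtain ⟨α, β, ⟨a, v⟩, b, w⟩ := x
  have h1 : ∑ i, sgn i * v i * v i = Qf v :=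
    Finset.sum_congr rfl fun i _ => by simp only [sgn]; ring
  have h2 : ∑ i, sgn i * (sgn i * w i) * (sgn i * w i) = Qf w :=
    Finset.sum_congr rfl fun i _ => by
      have : (if (i : ℕ) = 0 then (1 : ℝ) else -1) = sgn i := rfl
      rw [this]
      linear_combination sgn i * w i ^ 2 * sgn_mul_self i
  have h3 : ∑ i, sgn i * v i * (sgn i * w i) = ∑ i, v i * w i :=
    Finset.sum_congr rfl fun i _ => by linear_combination v i * w i * sgn_mul_self i
  have h4 : (∑ i : Fin n, (if (i : ℕ) = 0 then a * v i else -(a * v i)) *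
      (if (i : ℕ) = 0 then b * w i else -(b * w i))) = a * b * ∑ i, v i * w i := by
    rw [Finset.mul_sum]
    exact Finset.sum_congr rfl fun i _ => by split_ifs <;> ring
  simp only [Dlt, TrF, Nrm, sharp, bil_apply, coords_apply, h1, h2, h3, h4]
  ring

lemma symp_nondegenerate {x : F n} (h : ∀ z, symp x z = 0) : x = 0 := by
  refine (coords n).map_eq_zero_iff.mp (Prod.ext ?_ ?_)
  · refine bil_nondegenerate _ fun z => ?_
    simpa [symp_eq] using h ((coords n).symm (0, z))
  · refine bil_nondegenerate _ fun z => ?_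
    simpa [symp_eq] using h ((coords n).symm (z, 0))

/-- `SL(2, ℝ)` together with the isometries of `ℝ^{2,n}` acts by automorphisms. -/
lemma autRel_of_coords {x y : F n} {g : V n →ₗ[ℝ] V n} (hg : Isometry (bil n) g) {a b c d : ℝ}
    (hdet : a * d - b * c = 1)
    (h1 : g (a • (coords n x).1 + b • (coords n x).2) = (coords n y).1)
    (h2 : g (c • (coords n x).1 + d • (coords n x).2) = (coords n y).2) : AutRel x y := by
  let f : V n × V n →ₗ[ℝ] V n × V n :=
    (g ∘ₗ (a • LinearMap.fst ℝ _ _ + b • LinearMap.snd ℝ _ _)).prod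
      (g ∘ₗ (c • LinearMap.fst ℝ _ _ + d • LinearMap.snd ℝ _ _))
  let σ : F n →ₗ[ℝ] F n := (coords n).symm.toLinearMap ∘ₗ f ∘ₗ (coords n).toLinearMap
  have hσ1 : ∀ z, (coords n (σ z)).1 = g (a • (coords n z).1 + b • (coords n z).2) :=
    fun z => by simp [σ, f]
  have hσ2 : ∀ z, (coords n (σ z)).2 = g (c • (coords n z).1 + d • (coords n z).2) :=
    fun z => by simp [σ, f]
  have hsymp : ∀ z w, symp (σ z) (σ w) = symp z w := fun z w => by
    rw [symp_eq, symp_eq, hσ1, hσ2, hσ1, hσ2, hg, hg]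
    simp only [map_add, map_smul, LinearMap.add_apply, LinearMap.smul_apply, smul_eq_mul]
    linear_combination 2 * (bil n (coords n z).1 (coords n w).2
      - bil n (coords n z).2 (coords n w).1) * hdet
  have hinj : Function.Injective σ := (injective_iff_map_eq_zero σ).mpr fun z hz =>
    symp_nondegenerate fun w => by rw [← hsymp, hz]; simp [symp_eq]
  refine ⟨σ, ⟨⟨hinj, LinearMap.injective_iff_surjective.mp hinj⟩, σ.isLinear, hsymp, fun z => ?_⟩,
    (coords n).injective (Prod.ext ((hσ1 x).trans h1) ((hσ2 x).trans h2))⟩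
  rw [Dlt_eq, Dlt_eq, hσ1, hσ2, hg, hg, hg]
  simp only [map_add, map_smul, LinearMap.add_apply, LinearMap.smul_apply, smul_eq_mul,
    bil_comm (coords n z).2 (coords n z).1]
  linear_combination 4 * (a * d - b * c + 1) *
    (bil n (coords n z).1 (coords n z).1 * bil n (coords n z).2 (coords n z).2
      - bil n (coords n z).1 (coords n z).2 ^ 2) * hdet

end Coordinates

section TripleMap

variable {n : ℕ}

lemma deriv_quartic {E : Type*} [NormedAddCommGroup E] [NormedSpace ℝ E] (c₀ c₁ c₂ c₃ c₄ : E) :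
    deriv (fun s : ℝ => c₀ + s • c₁ + s ^ 2 • c₂ + s ^ 3 • c₃ + s ^ 4 • c₄) 0 = c₁ := by
  have hpow : ∀ (k : ℕ) (c : E),
      HasDerivAt (fun s : ℝ => s ^ k • c) (((k : ℝ) * (0 : ℝ) ^ (k - 1)) • c) 0 :=
    fun k c => (hasDerivAt_pow k (0 : ℝ)).smul_const c
  have h := ((((hasDerivAt_const (0 : ℝ) c₀).add ((hasDerivAt_id (0 : ℝ)).smul_const c₁)).add
    (hpow 2 c₂)).add (hpow 3 c₃)).add (hpow 4 c₄)
  have h' := h.deriv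
  simp only [zero_add, one_smul] at h'
  norm_num at h'
  exact h'

/-- The triple-product map in the coordinates `ℝ^{2,n} ⊕ ℝ^{2,n}`. -/
noncomputable def tripleCoords (y : V n × V n) : V n × V n :=
  ((2 : ℝ) • (bil n y.1 y.1 • y.2 - bil n y.1 y.2 • y.1),
    (2 : ℝ) • (bil n y.1 y.2 • y.2 - bil n y.2 y.2 • y.1))

lemma deriv_Dlt (x z : F n) : (1 / 2) * deriv (fun s : ℝ => Dlt (x + s • z)) 0 =
    symp ((coords n).symm (tripleCoords (coords n x))) z := by
  set P := (coords n x).1 with hP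
  set Q := (coords n x).2 with hQ
  set R := (coords n z).1 with hR
  set S := (coords n z).2 with hS
  have h : (fun s : ℝ => Dlt (x + s • z)) = fun s : ℝ =>
      4 * (bil n P P * bil n Q Q - bil n P Q ^ 2)
      + s • (8 * (bil n P R * bil n Q Q + bil n Q S * bil n P P
          - bil n P Q * (bil n P S + bil n Q R)))
      + s ^ 2 • (4 * (bil n P P * bil n S S + bil n R R * bil n Q Q
          + 4 * bil n P R * bil n Q S - 2 * bil n P Q * bil n R S - (bil n P S + bil n Q R) ^ 2))
      + s ^ 3 • (8 * (bil n P R * bil n S S + bil n Q S * bil n R R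
          - bil n R S * (bil n P S + bil n Q R)))
      + s ^ 4 • (4 * (bil n R R * bil n S S - bil n R S ^ 2)) := by
    funext s
    rw [Dlt_eq]
    simp only [map_add, map_smul, Prod.fst_add, Prod.snd_add, Prod.smul_fst, Prod.smul_snd,
      LinearMap.add_apply, LinearMap.smul_apply, smul_eq_mul, ← hP, ← hQ, ← hR, ← hS,
      bil_comm R P, bil_comm S Q, bil_comm R Q]
    ring
  rw [h, deriv_quartic, symp_eq, LinearEquiv.apply_symm_apply]
  simp only [tripleCoords, ← hP, ← hQ, ← hR, ← hS, map_smul, map_sub, LinearMap.sub_apply,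
    LinearMap.smul_apply, smul_eq_mul]
  ring

lemma tripleMap_eq {T : F n → F n} (hT : IsTripleMap T) (x : F n) :
    T x = (coords n).symm (tripleCoords (coords n x)) := by
  refine sub_eq_zero.mp (symp_nondegenerate fun z => ?_)
  have h := hT x z
  rw [deriv_Dlt, symp_eq, symp_eq] at h
  rw [symp_eq]
  simp only [map_sub, Prod.fst_sub, Prod.snd_sub, LinearMap.sub_apply]
  linarith

/-- Elements of rank at most one: `Υ` vanishes on isotropic pure tensors. -/
lemma ups_eq_zero {T : F n → F n} (hT : IsTripleMap T) {x : F n} {e : V n} {p q : ℝ}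
    (he : bil n e e = 0) (hP : (coords n x).1 = p • e) (hQ : (coords n x).2 = q • e) (y : F n) :
    Ups T x y = 0 := by
  set R := (coords n y).1 with hR
  set S := (coords n y).2 with hS
  have h : (fun s : ℝ => T (x + s • y)) = fun s : ℝ =>
      0 + s • (coords n).symm
        ((2 * (q * bil n e R - p * bil n e S)) • p • e,
          (2 * (q * bil n e R - p * bil n e S)) • q • e)
      + s ^ 2 • (coords n).symm
        ((2 : ℝ) • ((q * bil n R R) • e + (2 * p * bil n e R) • S - (p * bil n R S) • e
            - (p * bil n e S + q * bil n e R) • R),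
          (2 : ℝ) • ((p * bil n e S + q * bil n e R) • S + (q * bil n R S) • e
            - (2 * q * bil n e S) • R - (p * bil n S S) • e))
      + s ^ 3 • (coords n).symm (tripleCoords (R, S)) + s ^ 4 • (0 : F n) := by
    funext s
    rw [tripleMap_eq hT]
    apply (coords n).injective
    simp only [map_add, map_smul, map_zero, LinearEquiv.apply_symm_apply, tripleCoords,
      Prod.fst_add, Prod.snd_add, Prod.smul_fst, Prod.smul_snd,
      LinearMap.add_apply, LinearMap.smul_apply, smul_eq_mul, hP, hQ, ← hR, ← hS, he,
      bil_comm R e, bil_comm S e]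
    refine Prod.ext ?_ ?_
    · simp only [Prod.fst_add, Prod.smul_fst, Prod.fst_zero]
      module
    · simp only [Prod.snd_add, Prod.smul_snd, Prod.snd_zero]
      module
  rw [Ups, h, deriv_quartic]
  apply (coords n).injective
  rw [map_add, map_smul, LinearEquiv.apply_symm_apply, symp_eq, map_zero]
  refine Prod.ext ?_ ?_
  · simp only [Prod.fst_add, Prod.smul_fst, hP, hQ, ← hR, ← hS, map_smul, LinearMap.smul_apply,
      smul_eq_mul, Prod.fst_zero]
    module
  · simp only [Prod.snd_add, Prod.smul_snd, hP, hQ, ← hR, ← hS, map_smul, LinearMap.smul_apply,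
      smul_eq_mul, Prod.snd_zero]
    module

end TripleMap

section Orbits

variable {n : ℕ}

/-- Anisotropic pure tensors are classified by the sign of the square of their vector factor. -/
lemma autRel_of_anisotropic {x y : F n} {e : V n} {p q k : ℝ}
    (hP : (coords n x).1 = p • e) (hQ : (coords n x).2 = q • e) (hpq : p ^ 2 + q ^ 2 ≠ 0)
    (hk : 0 < k) (he : bil n (coords n y).2 (coords n y).2 = k * bil n e e)
    (hne : bil n e e ≠ 0) (hy : (coords n y).1 = 0) : AutRel x y := by
  have ht : √k ≠ 0 := (Real.sqrt_pos.mpr hk).ne'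
  have htt : √k * √k = k := Real.mul_self_sqrt hk.le
  obtain ⟨g, hg, hge⟩ := exists_isometry_of_anisotropic (B := bil n) bil_comm
    (u := √k • e) (w := (coords n y).2)
    (by simp only [map_smul, LinearMap.smul_apply, smul_eq_mul, he]
        rw [← mul_assoc, htt])
    (by simp only [map_smul, LinearMap.smul_apply, smul_eq_mul]
        positivity)
  refine autRel_of_coords hg (a := q / √k) (b := -(p / √k)) (c := √k * p / (p ^ 2 + q ^ 2))
    (d := √k * q / (p ^ 2 + q ^ 2)) ?_ ?_ ?_
  · field_simp
    ring
  · rw [hP, hQ, hy, smul_smul, smul_smul, ← add_smul]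
    convert map_zero g using 2
    convert zero_smul ℝ e using 2
    ring
  · rw [hP, hQ, ← hge, smul_smul, smul_smul, ← add_smul]
    congr 2
    field_simp

lemma autRel_pureTensor {x : F n} {e : V n} {p q : ℝ}
    (hP : (coords n x).1 = p • e) (hQ : (coords n x).2 = q • e) (hpq : p ^ 2 + q ^ 2 ≠ 0)
    (hne : bil n e e ≠ 0) :
    AutRel x (1, 0, ((1 : ℝ), (0 : Fin n → ℝ)), 0) ∨
      AutRel x (1, 0, ((-1 : ℝ), (0 : Fin n → ℝ)), 0) := by
  rcases lt_or_gt_of_ne hne with h | h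
  · refine Or.inl (autRel_of_anisotropic hP hQ hpq (k := -(bil n e e)⁻¹) ?_ ?_ hne ?_)
    · simpa using h
    · rw [neg_mul, inv_mul_cancel₀ hne]
      simp [coords_apply, bil_apply]
    · simp [coords_apply]
  · refine Or.inr (autRel_of_anisotropic hP hQ hpq (k := (bil n e e)⁻¹) ?_ ?_ hne ?_)
    · simpa using h
    · rw [inv_mul_cancel₀ hne]
      simp [coords_apply, bil_apply]
    · simp [coords_apply]

lemma sum_sgn_vec2 (hn : 2 ≤ n) (a : ℝ) :
    ∑ i : Fin n, sgn i * (vec2 a a : Fin n → ℝ) i * (vec2 a a : Fin n → ℝ) i = 0 := by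
  obtain ⟨m, rfl⟩ := Nat.exists_eq_add_of_le' hn
  simp [Fin.sum_univ_succ, sgn, vec2]

lemma autRel_isotropic_plane (hn : 2 ≤ n) {x : F n} (hp : (coords n x).1 ≠ 0)
    (hq : ∀ c : ℝ, (coords n x).2 ≠ c • (coords n x).1)
    (hpp : bil n (coords n x).1 (coords n x).1 = 0)
    (hqq : bil n (coords n x).2 (coords n x).2 = 0)
    (hpq : bil n (coords n x).1 (coords n x).2 = 0) :
    AutRel x (1, 0, ((0 : ℝ), vec2 (1 / 2) (1 / 2)), 0) := by
  obtain ⟨g, hg, hgp, hgq⟩ := exists_isometry_of_isotropic_plane bil_comm bil_nondegenerate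
    (p' := ((0, 0, vec2 (1 / 2) (1 / 2)) : V n)) (q' := ((0, 1, 0) : V n)) hp hq
    (fun h => by
      have h0 := congrFun (congrArg (fun u : V n => u.2.2) h) ⟨0, by omega⟩
      norm_num [vec2] at h0)
    (fun c h => by
      have h0 := congrArg (fun u : V n => u.2.1) h
      norm_num at h0)
    hpp hqq hpq (by simpa [bil_apply] using sum_sgn_vec2 hn (1 / 2)) (by simp [bil_apply])
    (by simp [bil_apply])
  refine autRel_of_coords hg (a := 1) (b := 0) (c := 0) (d := 1) (by norm_num) ?_ ?_
  · simp [coords_apply] at hgp ⊢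
    exact hgp
  · simp [coords_apply] at hgq ⊢
    exact hgq

end Orbits

end FTS

/-- every rank-2 element of `F^{2,n}` (`T(x) = 0` and `Υ(x, y) ≠ 0` for some
`y`) is `Aut`-related to `x_{2a} = (1, 0, (1;0), 0)`, `x_{2b} = (1, 0, (-1;0), 0)` or
`x_{2c} = (1, 0, (0;½,½), 0)`. -/
theorem fts_rank2_orbits (n : ℕ) (hn : 2 ≤ n) (T : F n → F n) (hT : IsTripleMap T)
    (x : F n) (h1 : T x = 0) (h2 : ∃ y, Ups T x y ≠ 0) :
    AutRel x (1, 0, ((1 : ℝ), (0 : Fin n → ℝ)), 0) ∨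
    AutRel x (1, 0, ((-1 : ℝ), (0 : Fin n → ℝ)), 0) ∨
    AutRel x (1, 0, ((0 : ℝ), vec2 (1 / 2) (1 / 2)), 0) := by
  open FTS in
  obtain ⟨y, hy⟩ := h2
  rw [tripleMap_eq hT, LinearEquiv.map_eq_zero_iff] at h1
  set P := (coords n x).1 with hP
  set Q := (coords n x).2 with hQ
  have hPQ : bil n P P • Q = bil n P Q • P := by
    have h := congrArg Prod.fst h1
    simpa [tripleCoords, sub_eq_zero, ← hP, ← hQ] using h
  have hQP : bil n P Q • Q = bil n Q Q • P := by
    have h := congrArg Prod.snd h1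
    simpa [tripleCoords, sub_eq_zero, ← hP, ← hQ] using h
  by_cases hpp : bil n P P = 0
  · by_cases hqq : bil n Q Q = 0
    · refine Or.inr (Or.inr (autRel_isotropic_plane hn (fun h0 => hy ?_) (fun c hc => hy ?_)
        hpp hqq ?_))
      · exact ups_eq_zero hT hqq (p := 0) (q := 1) (by simpa using h0) (by simp [← hQ]) y
      · exact ups_eq_zero hT hpp (p := 1) (q := c) (by simp [← hP]) hc y
      · rw [hpp, zero_smul, eq_comm, smul_eq_zero] at hPQ
        rcases hPQ with h | h
        · exact h
        · simp [← hP, h]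
    · rw [← or_assoc]
      refine Or.inl (autRel_pureTensor (e := Q) (p := bil n P Q / bil n Q Q) (q := 1) ?_
        (by simp [← hQ]) (by positivity) hqq)
      rw [div_eq_inv_mul, mul_smul, hQP, inv_smul_smul₀ hqq]
  · rw [← or_assoc]
    refine Or.inl (autRel_pureTensor (e := P) (p := 1) (q := bil n P Q / bil n P P)
      (by simp [← hP]) ?_ (by positivity) hpp)
    rw [div_eq_inv_mul, mul_smul, ← hPQ, inv_smul_smul₀ hpp]
end

section
/- Let n ≥ 2. Every rank-4 element of F^{2,n}, i.e. every x with Δ(x) ≠ 0, is Aut-related, for some k > 0, to one of the canonical forms x_{4a} = k·(1, 0, (−1; 1, 0, …, 0), 0), x_{4b} = k·(1, 0, (1; 0, 1, 0, …, 0), 0), or x_{4c} = k·(1, 0, (−1; 0, 1, 0, …, 0), 0). -/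
open Real Matrix

section Isometry

variable {V : Type*} [AddCommGroup V] [Module ℝ V] {B : LinearMap.BilinForm ℝ V}

/-- The reflection in an anisotropic vector: an isometry negating the vector and fixing its
orthogonal complement. -/
lemma exists_isometry_reflection (hB : ∀ x y, B x y = B y x) {x : V} (hx : B x x ≠ 0) :
    ∃ g : V ≃ₗ[ℝ] V, (∀ y z, B (g y) (g z) = B y z) ∧
      ∀ y, g y = y - (2 / B x x * B x y) • x := by
  have hf : ((2 / B x x) • B x) x = 2 := by
    simp only [LinearMap.smul_apply, smul_eq_mul]
    field_simp
  refine ⟨Module.reflection hf, fun y z => ?_, fun y => by simp [Module.reflection_apply]⟩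
  simp only [Module.reflection_apply, LinearMap.smul_apply, smul_eq_mul, map_sub, map_smul,
    LinearMap.sub_apply, hB y x]
  field_simp
  ring

/-- An isometry carrying `x` to `y` up to sign, by a reflection in `x - y` or `x + y`. -/
lemma exists_isometry_apply_eq_or_neg (hB : ∀ x y, B x y = B y x) {x y : V}
    (hx : B x x ≠ 0) (hxy : B x x = B y y) :
    ∃ g : V ≃ₗ[ℝ] V, (∀ y z, B (g y) (g z) = B y z) ∧ (g x = y ∨ g x = -y) ∧
      ∀ z, B x z = 0 → B y z = 0 → g z = z := by
  by_cases h : B (x - y) (x - y) = 0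
  · have h2 : B (x + y) (x + y) = 2 * B x (x + y) := by
      simp only [map_add, LinearMap.add_apply, hB y x]; linarith
    have h' : B (x + y) (x + y) ≠ 0 := by
      intro h0
      simp only [map_add, map_sub, LinearMap.add_apply, LinearMap.sub_apply] at h h0
      exact hx (by linarith)
    obtain ⟨g, hg, hgf⟩ := exists_isometry_reflection hB h'
    refine ⟨g, hg, Or.inr ?_, fun z h1 h2 => by simp [hgf, h1, h2]⟩
    have : 2 / B (x + y) (x + y) * B (x + y) x = 1 := by
      rw [hB (x + y) x, div_mul_eq_mul_div, ← h2, div_self h']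
    rw [hgf, this]
    simp
  · have h2 : B (x - y) (x - y) = 2 * B x (x - y) := by
      simp only [map_sub, LinearMap.sub_apply, hB y x]; linarith
    obtain ⟨g, hg, hgf⟩ := exists_isometry_reflection hB h
    refine ⟨g, hg, Or.inl ?_, fun z h1 h2 => by simp [hgf, h1, h2]⟩
    have : 2 / B (x - y) (x - y) * B (x - y) x = 1 := by
      rw [hB (x - y) x, div_mul_eq_mul_div, ← h2, div_self h]
    rw [hgf, this]
    simp

/-- Vectors of equal nonzero norm are related by an isometry which fixes every vector orthogonal
to both. -/
lemma exists_isometry_apply_eq (hB : ∀ x y, B x y = B y x) {x y : V}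
    (hx : B x x ≠ 0) (hxy : B x x = B y y) :
    ∃ g : V ≃ₗ[ℝ] V, (∀ y z, B (g y) (g z) = B y z) ∧ g x = y ∧
      ∀ z, B x z = 0 → B y z = 0 → g z = z := by
  obtain ⟨g, hg, h | h, hfix⟩ := exists_isometry_apply_eq_or_neg hB hx hxy
  · exact ⟨g, hg, h, hfix⟩
  · have hy : B y y ≠ 0 := hxy ▸ hx
    obtain ⟨r, hr, hrf⟩ := exists_isometry_reflection hB hy
    refine ⟨g.trans r, fun a b => by simp [hr, hg], ?_, fun z h1 h2 => ?_⟩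
    · have : 2 / B y y * B y (-y) = -2 := by
        rw [map_neg]; field_simp
      rw [LinearEquiv.trans_apply, h, hrf, this]
      module
    · simp [hfix z h1 h2, hrf, h2]

/-- Witt's theorem for orthogonal pairs of anisotropic vectors. -/
lemma exists_isometry_apply_eq_pair (hB : ∀ x y, B x y = B y x) {x₁ x₂ y₁ y₂ : V}
    (h₁ : B x₁ x₁ ≠ 0) (h₂ : B x₂ x₂ ≠ 0) (hx : B x₁ x₂ = 0) (hy : B y₁ y₂ = 0)
    (e₁ : B x₁ x₁ = B y₁ y₁) (e₂ : B x₂ x₂ = B y₂ y₂) :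
    ∃ g : V ≃ₗ[ℝ] V, (∀ y z, B (g y) (g z) = B y z) ∧ g x₁ = y₁ ∧ g x₂ = y₂ := by
  obtain ⟨g, hg, hg₁, -⟩ := exists_isometry_apply_eq hB h₁ e₁
  obtain ⟨r, hr, hr₂, hfix⟩ := exists_isometry_apply_eq hB (x := g x₂) (y := y₂)
    (by rwa [hg]) (by rwa [hg])
  refine ⟨g.trans r, fun a b => by simp [hr, hg], ?_, by simpa using hr₂⟩
  rw [LinearEquiv.trans_apply, hg₁]
  refine hfix _ ?_ (by rw [hB, hy])
  rw [← hg₁, hg, hB, hx]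

end Isometry

/-- A nondegenerate binary quadratic form is diagonalized by `SL(2, ℝ)` with diagonal entries
of equal absolute value. -/
lemma exists_sl2_diagonalization {p q r : ℝ} (h : p * r - q ^ 2 ≠ 0) :
    ∃ c s t u v : ℝ, 0 < c ∧ s * v - t * u = 1 ∧
      p * s * u + q * (s * v + t * u) + r * t * v = 0 ∧
      ((p * s ^ 2 + 2 * q * s * t + r * t ^ 2 = c ∧ p * u ^ 2 + 2 * q * u * v + r * v ^ 2 = c) ∨
       (p * s ^ 2 + 2 * q * s * t + r * t ^ 2 = -c ∧
          p * u ^ 2 + 2 * q * u * v + r * v ^ 2 = -c) ∨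
       (p * s ^ 2 + 2 * q * s * t + r * t ^ 2 = c ∧
          p * u ^ 2 + 2 * q * u * v + r * v ^ 2 = -c)) := by
  obtain ⟨s, t, hm⟩ : ∃ s t : ℝ, p * s ^ 2 + 2 * q * s * t + r * t ^ 2 ≠ 0 := by
    by_contra! H
    have h1 := H 1 0
    have h2 := H 0 1
    have h3 := H 1 1
    refine h ?_
    have hp : p = 0 := by linarith
    have hq : q = 0 := by linarith
    simp [hp, hq]
  set d := p * r - q ^ 2 with hd
  set m := p * s ^ 2 + 2 * q * s * t + r * t ^ 2 with hmd
  have hc : 0 < √|d| := by positivity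
  have hc2 : √|d| ^ 2 = |d| := Real.sq_sqrt (abs_nonneg d)
  have hl : 0 < √(√|d| / |m|) := by positivity
  have hl2 : √(√|d| / |m|) ^ 2 = √|d| / |m| := Real.sq_sqrt (by positivity)
  generalize √(√|d| / |m|) = l at hl hl2
  generalize √|d| = c at hc hc2 hl2
  have hl3 : l ^ 2 * |m| = c := by rw [hl2]; field_simp
  set u := -(q * s + r * t) / (m * l) with hu
  set v := (p * s + q * t) / (m * l) with hv
  have hdet : l * s * v - l * t * u = 1 := by
    rw [hu, hv]; field_simp; rw [hmd]; ring
  have horth : p * (l * s) * u + q * (l * s * v + l * t * u) + r * (l * t) * v = 0 := by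
    rw [hu, hv]; field_simp; ring
  have hn1 : p * (l * s) ^ 2 + 2 * q * (l * s) * (l * t) + r * (l * t) ^ 2 = l ^ 2 * m := by
    rw [hmd]; ring
  have hn2 : p * u ^ 2 + 2 * q * u * v + r * v ^ 2 = d / (l ^ 2 * m) := by
    have : p * u ^ 2 + 2 * q * u * v + r * v ^ 2 = d * m / (m * l) ^ 2 := by
      have key : p * (q * s + r * t) ^ 2 - 2 * q * (q * s + r * t) * (p * s + q * t) +
          r * (p * s + q * t) ^ 2 = d * m := by rw [hd, hmd]; ring
      rw [hu, hv, ← key]; clear_value m; field_simp; ring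
    rw [this]; field_simp
  rcases lt_or_gt_of_ne hm with hm0 | hm0 <;> rcases lt_or_gt_of_ne h with hd0 | hd0
  · rw [abs_of_neg hm0] at hl3
    rw [abs_of_neg hd0] at hc2
    have e : l ^ 2 * m = -c := by linarith
    refine ⟨c, u, v, -(l * s), -(l * t), hc, by linarith, by linarith, .inr (.inr ⟨?_, ?_⟩)⟩
    · rw [hn2, e, div_eq_iff (by linarith)]; linarith
    · rw [← e, ← hn1]; ring
  · rw [abs_of_neg hm0] at hl3
    rw [abs_of_pos hd0] at hc2
    have e : l ^ 2 * m = -c := by linarith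
    refine ⟨c, l * s, l * t, u, v, hc, hdet, horth, .inr (.inl ⟨by rw [hn1, e], ?_⟩)⟩
    rw [hn2, e, div_eq_iff (by linarith)]; linarith
  · rw [abs_of_pos hm0] at hl3
    rw [abs_of_neg hd0] at hc2
    refine ⟨c, l * s, l * t, u, v, hc, hdet, horth, .inr (.inr ⟨by rw [hn1, hl3], ?_⟩)⟩
    rw [hn2, hl3, div_eq_iff hc.ne']; linarith
  · rw [abs_of_pos hm0] at hl3
    rw [abs_of_pos hd0] at hc2
    refine ⟨c, l * s, l * t, u, v, hc, hdet, horth, .inl ⟨by rw [hn1, hl3], ?_⟩⟩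
    rw [hn2, hl3, div_eq_iff hc.ne']; linarith

/-- The quadratic space of signature `(2, n)`: a hyperbolic plane plus the Lorentzian space. -/
abbrev ConformalSpace (n : ℕ) : Type := ℝ × ℝ × (Fin n → ℝ)

/-- The sign `1` at the time coordinate and `-1` at the space coordinates. -/
def lorentzSign {n : ℕ} (i : Fin n) : ℝ := if (i : ℕ) = 0 then 1 else -1

lemma lorentzSign_mul_self {n : ℕ} (i : Fin n) : lorentzSign i * lorentzSign i = 1 := by
  unfold lorentzSign; split_ifs <;> norm_num

/-- The Lorentzian bilinear form `v₀w₀ - v₁w₁ - ⋯`. -/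
noncomputable def lorentzForm (n : ℕ) : LinearMap.BilinForm ℝ (Fin n → ℝ) :=
  LinearMap.mk₂ ℝ (fun v w => ∑ i, lorentzSign i * v i * w i)
    (fun _ _ _ => by
      simp only [Pi.add_apply, mul_add, add_mul, Finset.sum_add_distrib])
    (fun _ _ _ => by
      simp only [Pi.smul_apply, smul_eq_mul, Finset.mul_sum]
      exact Finset.sum_congr rfl fun _ _ => by ring)
    (fun _ _ _ => by
      simp only [Pi.add_apply, mul_add, Finset.sum_add_distrib])
    (fun _ _ _ => by
      simp only [Pi.smul_apply, smul_eq_mul, Finset.mul_sum]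
      exact Finset.sum_congr rfl fun _ _ => by ring)

lemma lorentzForm_apply {n : ℕ} (v w : Fin n → ℝ) :
    lorentzForm n v w = ∑ i, lorentzSign i * v i * w i := rfl

/-- The polar form of the quadratic form `Q(v) - x y` of signature `(2, n)`. -/
noncomputable def conformalForm (n : ℕ) : LinearMap.BilinForm ℝ (ConformalSpace n) :=
  LinearMap.mk₂ ℝ (fun P R => 2 * lorentzForm n P.2.2 R.2.2 - (P.1 * R.2.1 + P.2.1 * R.1))
    (fun _ _ _ => by
      simp only [Prod.fst_add, Prod.snd_add, map_add, LinearMap.add_apply]; ring)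
    (fun _ _ _ => by
      simp only [Prod.smul_fst, Prod.smul_snd, map_smul, LinearMap.smul_apply, smul_eq_mul]; ring)
    (fun _ _ _ => by simp only [Prod.fst_add, Prod.snd_add, map_add]; ring)
    (fun _ _ _ => by simp only [Prod.smul_fst, Prod.smul_snd, map_smul, smul_eq_mul]; ring)

lemma conformalForm_apply {n : ℕ} (P R : ConformalSpace n) :
    conformalForm n P R = 2 * lorentzForm n P.2.2 R.2.2 - (P.1 * R.2.1 + P.2.1 * R.1) := rfl

lemma lorentzForm_comm {n : ℕ} (v w : Fin n → ℝ) : lorentzForm n v w = lorentzForm n w v := by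
  simp only [lorentzForm_apply]
  exact Finset.sum_congr rfl fun _ _ => by ring

lemma conformalForm_comm {n : ℕ} (P R : ConformalSpace n) :
    conformalForm n P R = conformalForm n R P := by
  rw [conformalForm_apply, conformalForm_apply, lorentzForm_comm]; ring

lemma lorentzForm_self {n : ℕ} (v : Fin n → ℝ) : lorentzForm n v v = Qf v := by
  rw [lorentzForm_apply]
  exact Finset.sum_congr rfl fun _ _ => by unfold lorentzSign; ring

/-- The identification `F^{2,n} ≅ ℝ² ⊗ ℝ^{2,n}`. -/
def pairEquiv (n : ℕ) : F n ≃ₗ[ℝ] ConformalSpace n × ConformalSpace n where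
  toFun x := ((x.1, x.2.2.1.1, fun i => lorentzSign i * x.2.2.2.2 i),
    (x.2.2.2.1, x.2.1, x.2.2.1.2))
  invFun p := (p.1.1, p.2.2.1, (p.1.2.1, p.2.2.2), (p.2.1, fun i => lorentzSign i * p.1.2.2 i))
  map_add' x y := by
    ext <;> simp [mul_add]
  map_smul' c x := by
    ext <;> simp [mul_left_comm]
  left_inv x := by
    ext <;> simp [← mul_assoc, lorentzSign_mul_self]
  right_inv x := by
    ext <;> simp [← mul_assoc, lorentzSign_mul_self]

lemma pairEquiv_apply {n : ℕ} (x : F n) :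
    pairEquiv n x = ((x.1, x.2.2.1.1, fun i => lorentzSign i * x.2.2.2.2 i),
      (x.2.2.2.1, x.2.1, x.2.2.1.2)) := rfl

lemma lorentzForm_sign_left {n : ℕ} (v w : Fin n → ℝ) :
    lorentzForm n (fun i => lorentzSign i * v i) w = ∑ i, v i * w i := by
  rw [lorentzForm_apply]
  exact Finset.sum_congr rfl fun i _ => by rw [← mul_assoc, lorentzSign_mul_self, one_mul]

lemma Qf_sign {n : ℕ} (v : Fin n → ℝ) : Qf (fun i => lorentzSign i * v i) = Qf v :=
  Finset.sum_congr rfl fun i _ => by rw [mul_pow, sq (lorentzSign i), lorentzSign_mul_self, one_mul]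

lemma sum_comm_mul {n : ℕ} (v w : Fin n → ℝ) : ∑ i, v i * w i = ∑ i, w i * v i :=
  Finset.sum_congr rfl fun _ _ => mul_comm _ _

lemma symp_eq {n : ℕ} (x y : F n) :
    symp x y = conformalForm n (pairEquiv n x).2 (pairEquiv n y).1 -
      conformalForm n (pairEquiv n x).1 (pairEquiv n y).2 := by
  obtain ⟨α, β, ⟨a, v⟩, ⟨b, w⟩⟩ := x
  obtain ⟨γ, δ, ⟨c, v'⟩, ⟨d, w'⟩⟩ := y
  rw [conformalForm_comm (pairEquiv n _).2]
  simp only [pairEquiv_apply, conformalForm_apply, lorentzForm_sign_left, symp, TrF,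
    sum_comm_mul v w']
  ring

lemma TrF_sharp {n : ℕ} (A B : J n) :
    TrF (sharp A) (sharp B) = Qf A.2 * Qf B.2 + 2 * (A.1 * B.1 * ∑ i, A.2 i * B.2 i) := by
  unfold TrF sharp
  rw [Finset.mul_sum (a := A.1 * B.1)]
  congr 2
  exact Finset.sum_congr rfl fun i _ => by dsimp only; split_ifs <;> ring

lemma Dlt_eq {n : ℕ} (x : F n) :
    Dlt x = conformalForm n (pairEquiv n x).1 (pairEquiv n x).1 *
        conformalForm n (pairEquiv n x).2 (pairEquiv n x).2 -
      conformalForm n (pairEquiv n x).1 (pairEquiv n x).2 ^ 2 := by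
  obtain ⟨α, β, ⟨a, v⟩, ⟨b, w⟩⟩ := x
  simp only [pairEquiv_apply, conformalForm_apply, lorentzForm_self, Qf_sign,
    lorentzForm_sign_left, Dlt, TrF_sharp, Nrm]
  simp only [TrF, sum_comm_mul w v]
  ring

/-- `SL(2, ℝ)` acting on pairs of vectors. -/
def sl2Equiv {V : Type*} [AddCommGroup V] [Module ℝ V] (s t u v : ℝ) (h : s * v - t * u = 1) :
    (V × V) ≃ₗ[ℝ] V × V where
  toFun p := (s • p.1 + t • p.2, u • p.1 + v • p.2)
  invFun p := (v • p.1 - t • p.2, s • p.2 - u • p.1)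
  map_add' p q := by
    refine Prod.ext ?_ ?_ <;> simp <;> module
  map_smul' c p := by
    refine Prod.ext ?_ ?_ <;> simp <;> module
  left_inv p := by
    refine Prod.ext ?_ ?_ <;> dsimp only
    · linear_combination (norm := module) congrArg (· • p.1) h
    · linear_combination (norm := module) congrArg (· • p.2) h
  right_inv p := by
    refine Prod.ext ?_ ?_ <;> dsimp only
    · linear_combination (norm := module) congrArg (· • p.1) h
    · linear_combination (norm := module) congrArg (· • p.2) h

/-- `SL(2, ℝ) × O(2, n)` acts by automorphisms. -/
lemma autRel_of_sl2_of_isometry {n : ℕ} {x y : F n} {s t u v : ℝ} (h : s * v - t * u = 1)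
    (g : ConformalSpace n ≃ₗ[ℝ] ConformalSpace n)
    (hg : ∀ P R, conformalForm n (g P) (g R) = conformalForm n P R)
    (h₁ : g (s • (pairEquiv n x).1 + t • (pairEquiv n x).2) = (pairEquiv n y).1)
    (h₂ : g (u • (pairEquiv n x).1 + v • (pairEquiv n x).2) = (pairEquiv n y).2) :
    AutRel x y := by
  let σ : F n ≃ₗ[ℝ] F n :=
    (pairEquiv n).trans <| (sl2Equiv s t u v h).trans <| (g.prodCongr g).trans (pairEquiv n).symm
  have hσ (z : F n) : pairEquiv n (σ z) = (g (s • (pairEquiv n z).1 + t • (pairEquiv n z).2),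
      g (u • (pairEquiv n z).1 + v • (pairEquiv n z).2)) :=
    (pairEquiv n).apply_symm_apply _
  refine ⟨σ, ⟨σ.bijective, σ.toLinearMap.isLinear, fun z w => ?_, fun z => ?_⟩, ?_⟩
  · simp only [symp_eq, hσ, hg, map_add, map_smul, LinearMap.add_apply, LinearMap.smul_apply,
      smul_eq_mul]
    linear_combination (conformalForm n (pairEquiv n z).2 (pairEquiv n w).1 -
      conformalForm n (pairEquiv n z).1 (pairEquiv n w).2) * h
  · simp only [Dlt_eq, hσ, hg, map_add, map_smul, LinearMap.add_apply, LinearMap.smul_apply,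
      smul_eq_mul]
    rw [conformalForm_comm (pairEquiv n z).2 (pairEquiv n z).1]
    generalize conformalForm n (pairEquiv n z).1 (pairEquiv n z).1 = p
    generalize conformalForm n (pairEquiv n z).1 (pairEquiv n z).2 = q
    generalize conformalForm n (pairEquiv n z).2 (pairEquiv n z).2 = r
    linear_combination (p * r - q ^ 2) * (s * v - t * u + 1) * h
  · exact (pairEquiv n).injective ((hσ x).trans (Prod.ext h₁ h₂))

lemma Qf_vec2 {n : ℕ} (hn : 2 ≤ n) (x y : ℝ) : Qf (vec2 x y : Fin n → ℝ) = x ^ 2 - y ^ 2 := by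
  obtain ⟨m, rfl⟩ := Nat.exists_eq_add_of_le' hn
  simp [Qf, vec2, Fin.sum_univ_succ]
  ring

/-- The pair of vectors attached to the canonical form `k (1, 0, (a; v), 0)`. -/
lemma pairEquiv_canonical {n : ℕ} (k a : ℝ) (v : Fin n → ℝ) :
    pairEquiv n (k • ((1 : ℝ), (0 : ℝ), (a, v), (0 : J n))) = ((k, k * a, 0), (0, 0, k • v)) := by
  ext <;> simp [pairEquiv_apply]

lemma autRel_canonical {n : ℕ} {x : F n} {k a s t u v : ℝ} {w : Fin n → ℝ}
    (h : s * v - t * u = 1)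
    (h₁ : conformalForm n (s • (pairEquiv n x).1 + t • (pairEquiv n x).2)
      (s • (pairEquiv n x).1 + t • (pairEquiv n x).2) = -(2 * k ^ 2 * a))
    (h₂ : conformalForm n (u • (pairEquiv n x).1 + v • (pairEquiv n x).2)
      (u • (pairEquiv n x).1 + v • (pairEquiv n x).2) = 2 * k ^ 2 * Qf w)
    (h₁₂ : conformalForm n (s • (pairEquiv n x).1 + t • (pairEquiv n x).2)
      (u • (pairEquiv n x).1 + v • (pairEquiv n x).2) = 0)
    (hk : k ≠ 0) (ha : a ≠ 0) (hw : Qf w ≠ 0) :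
    AutRel x (k • ((1 : ℝ), (0 : ℝ), (a, w), (0 : J n))) := by
  obtain ⟨g, hg, hg₁, hg₂⟩ := exists_isometry_apply_eq_pair conformalForm_comm
    (y₁ := (k, k * a, 0)) (y₂ := (0, 0, k • w)) (by rw [h₁]; simp [hk, ha])
    (by rw [h₂]; simp [hk, hw]) h₁₂ (by simp [conformalForm_apply])
    (by rw [h₁]; simp [conformalForm_apply]; ring)
    (by rw [h₂]; simp [conformalForm_apply, lorentzForm_self]; ring)
  refine autRel_of_sl2_of_isometry h g hg ?_ ?_ <;> rw [pairEquiv_canonical] <;> assumption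

/-- every rank-4 element of `F^{2,n}` (`Δ(x) ≠ 0`) is `Aut`-related, for
some `k > 0`, to `x_{4a} = k(1, 0, (-1;1,0), 0)`, `x_{4b} = k(1, 0, (1;0,1), 0)` or
`x_{4c} = k(1, 0, (-1;0,1), 0)`. -/
theorem fts_rank4_orbits (n : ℕ) (hn : 2 ≤ n) (x : F n) (h : Dlt x ≠ 0) :
    ∃ k : ℝ, 0 < k ∧
      (AutRel x (k • ((1 : ℝ), (0 : ℝ), ((-1 : ℝ), vec2 1 0), (0 : J n))) ∨
       AutRel x (k • ((1 : ℝ), (0 : ℝ), ((1 : ℝ), vec2 0 1), (0 : J n))) ∨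
       AutRel x (k • ((1 : ℝ), (0 : ℝ), ((-1 : ℝ), vec2 0 1), (0 : J n)))) := by
  obtain ⟨c, s, t, u, v, hc, hdet, horth, hcases⟩ := exists_sl2_diagonalization (Dlt_eq x ▸ h)
  have hk : 0 < √(c / 2) := by positivity
  have hk2 : 2 * √(c / 2) ^ 2 = c := by rw [Real.sq_sqrt (by positivity)]; ring
  have hform (s t u v : ℝ) : conformalForm n (s • (pairEquiv n x).1 + t • (pairEquiv n x).2)
      (u • (pairEquiv n x).1 + v • (pairEquiv n x).2) =
      conformalForm n (pairEquiv n x).1 (pairEquiv n x).1 * s * u +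
        conformalForm n (pairEquiv n x).1 (pairEquiv n x).2 * (s * v + t * u) +
        conformalForm n (pairEquiv n x).2 (pairEquiv n x).2 * t * v := by
    simp only [map_add, map_smul, LinearMap.add_apply, LinearMap.smul_apply, smul_eq_mul,
      conformalForm_comm (pairEquiv n x).2 (pairEquiv n x).1]
    ring
  refine ⟨√(c / 2), hk, ?_⟩
  rcases hcases with ⟨h₁, h₂⟩ | ⟨h₁, h₂⟩ | ⟨h₁, h₂⟩
  · refine .inl (autRel_canonical hdet ?_ ?_ ((hform s t u v).trans horth) hk.ne' (by norm_num)
      (by norm_num [Qf_vec2 hn])) <;> rw [hform, hk2]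
    · linarith
    · rw [Qf_vec2 hn]; linarith
  · refine .inr (.inl (autRel_canonical hdet ?_ ?_ ((hform s t u v).trans horth) hk.ne'
      (by norm_num) (by norm_num [Qf_vec2 hn]))) <;> rw [hform, hk2]
    · linarith
    · rw [Qf_vec2 hn]; linarith
  · refine .inr (.inr (autRel_canonical hdet ?_ ?_ ((hform s t u v).trans horth) hk.ne'
      (by norm_num) (by norm_num [Qf_vec2 hn]))) <;> rw [hform, hk2]
    · linarith
    · rw [Qf_vec2 hn]; linarith
end
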